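/- Let H_C and H_A be Hilbert spaces and, for i = 1,…,d, let C_i ∈ B(H_C), A_i ∈ B(H_A) and B_i ∈ B(H_C, H_A), and set E_i := [[C_i, 0],[B_i, A_i]] on H_C ⊕ H_A. Then E = (E_1,…,E_d) is a row contraction if and only if C = (C_1,…,C_d) and A = (A_1,…,A_d) are row contractions and there exists a contraction γ : 𝒟_{*,A} → 𝒟_C such that 𝐁* = D_C ∘ γ ∘ D_{*,A} as operators H_A → H_C^d (here γ is composed with the inclusion 𝒟_C ⊆ H_C^d, D_{*,A} is viewed as a map H_A → 𝒟_{*,A}, and 𝐁 : H_C^d → H_A is the row operator of (B_1,…,B_d)). -/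

import Mathlib

noncomputable section

/-- The Hilbert space `ℓ²`-direct sum of `d` copies of `H`. -/
abbrev Hd (d : ℕ) (H : Type*) : Type _ := PiLp 2 fun _ : Fin d => H

/-- The row operator `𝐀 : H^d → K`, `(h_1, …, h_d) ↦ Σ_i A_i h_i`, of a `d`-tuple of
bounded operators `A_i : H → K`. -/
noncomputable def rowOp {d : ℕ} {H K : Type*} [NormedAddCommGroup H] [InnerProductSpace ℂ H]
    [NormedAddCommGroup K] [InnerProductSpace ℂ K] (A : Fin d → (H →L[ℂ] K)) :
    Hd d H →L[ℂ] K :=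
  ∑ i, (A i).comp ((ContinuousLinearMap.proj i).comp
    (PiLp.continuousLinearEquiv 2 ℂ fun _ : Fin d => H).toContinuousLinearMap)

/-- The `i`-th coordinate inclusion `ι_i : H → H^d`. -/
noncomputable def inclPi {d : ℕ} {H : Type*} [NormedAddCommGroup H] [InnerProductSpace ℂ H]
    (i : Fin d) : H →L[ℂ] Hd d H :=
  ((PiLp.continuousLinearEquiv 2 ℂ fun _ : Fin d => H).symm.toContinuousLinearMap).comp
    (ContinuousLinearMap.pi fun j => if j = i then ContinuousLinearMap.id ℂ H else 0)

/-- First coordinate projection of the Hilbert direct sum `H ⊕ K`. -/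
noncomputable def prodFst {H K : Type*} [NormedAddCommGroup H] [InnerProductSpace ℂ H]
    [NormedAddCommGroup K] [InnerProductSpace ℂ K] : WithLp 2 (H × K) →L[ℂ] H :=
  (ContinuousLinearMap.fst ℂ H K).comp (WithLp.prodContinuousLinearEquiv 2 ℂ H K).toContinuousLinearMap

/-- Second coordinate projection of the Hilbert direct sum `H ⊕ K`. -/
noncomputable def prodSnd {H K : Type*} [NormedAddCommGroup H] [InnerProductSpace ℂ H]
    [NormedAddCommGroup K] [InnerProductSpace ℂ K] : WithLp 2 (H × K) →L[ℂ] K :=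
  (ContinuousLinearMap.snd ℂ H K).comp (WithLp.prodContinuousLinearEquiv 2 ℂ H K).toContinuousLinearMap

/-- The `2 × 2` block operator `[[T₁₁, T₁₂], [T₂₁, T₂₂]] : H ⊕ K → H' ⊕ K'`. -/
noncomputable def block2 {H K H' K' : Type*}
    [NormedAddCommGroup H] [InnerProductSpace ℂ H] [NormedAddCommGroup K] [InnerProductSpace ℂ K]
    [NormedAddCommGroup H'] [InnerProductSpace ℂ H'] [NormedAddCommGroup K'] [InnerProductSpace ℂ K']
    (T11 : H →L[ℂ] H') (T12 : K →L[ℂ] H') (T21 : H →L[ℂ] K') (T22 : K →L[ℂ] K') :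
    WithLp 2 (H × K) →L[ℂ] WithLp 2 (H' × K') :=
  ((WithLp.prodContinuousLinearEquiv 2 ℂ H' K').symm.toContinuousLinearMap).comp
    ((T11.comp prodFst + T12.comp prodSnd).prod (T21.comp prodFst + T22.comp prodSnd))

/-- The defect space of a defect operator `D : H → K`: the closure of its range. -/
abbrev defectSpace {H K : Type*} [NormedAddCommGroup H] [InnerProductSpace ℂ H]
    [NormedAddCommGroup K] [InnerProductSpace ℂ K] (D : H →L[ℂ] K) : Submodule ℂ K :=
  (LinearMap.range (D : H →ₗ[ℂ] K)).topologicalClosure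

/-- A defect operator `D : H → K`, viewed as a map into its defect space. -/
noncomputable def toDefect {H K : Type*} [NormedAddCommGroup H] [InnerProductSpace ℂ H]
    [NormedAddCommGroup K] [InnerProductSpace ℂ K] (D : H →L[ℂ] K) : H →L[ℂ] ↥(defectSpace D) :=
  D.codRestrict _ fun x => Submodule.le_topologicalClosure _ (LinearMap.mem_range_self _ x)

/-- The canonical identification `(H ⊕ K)^d ≅ H^d ⊕ K^d`:  from a pair
`(h, k) ∈ H^d ⊕ K^d` form the element of `(H ⊕ K)^d` with `i`-th entry `(h_i, k_i)`. -/
noncomputable def pairup {d : ℕ} {H K : Type*} [NormedAddCommGroup H] [InnerProductSpace ℂ H]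
    [NormedAddCommGroup K] [InnerProductSpace ℂ K] (h : Hd d H) (k : Hd d K) :
    Hd d (WithLp 2 (H × K)) :=
  (WithLp.equiv 2 _).symm fun i =>
    (WithLp.equiv 2 (H × K)).symm ((WithLp.equiv 2 _) h i, (WithLp.equiv 2 _) k i)


/-- A finite `ℓ²`-direct sum of complete spaces is complete. -/
instance PiLp.instCompleteSpaceOfFintype (p : ENNReal) [Fact (1 ≤ p)] {ι : Type*} [Fintype ι]
    (β : ι → Type*) [∀ i, NormedAddCommGroup (β i)] [∀ i, CompleteSpace (β i)] :
    CompleteSpace (PiLp p β) := by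
  have e : PiLp p β ≃ᵤ (∀ i, β i) :=
    { toEquiv := WithLp.equiv p _
      uniformContinuous_toFun := (PiLp.lipschitzWith_ofLp p β).uniformContinuous
      uniformContinuous_invFun := ((PiLp.antilipschitzWith_ofLp p β).to_rightInverse
        (fun _ => rfl)).uniformContinuous }
  exact e.completeSpace_iff.mpr inferInstance


section Aux

open ContinuousLinearMap

theorem aux_dense {H K : Type*} [NormedAddCommGroup H] [InnerProductSpace ℂ H]
    [NormedAddCommGroup K] [InnerProductSpace ℂ K] (D : H →L[ℂ] K) :
    DenseRange (toDefect D) := by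
  intro y
  have hy : (y : K) ∈ closure (Set.range D) := by
    have := y.2
    rw [← SetLike.mem_coe, Submodule.topologicalClosure_coe] at this
    exact this
  rw [Metric.mem_closure_iff] at hy ⊢
  intro ε hε
  obtain ⟨b, ⟨x, rfl⟩, hb⟩ := hy ε hε
  exact ⟨toDefect D x, ⟨x, rfl⟩, hb⟩

theorem aux_norm_toDefect {H K : Type*} [NormedAddCommGroup H] [InnerProductSpace ℂ H]
    [NormedAddCommGroup K] [InnerProductSpace ℂ K] (D : H →L[ℂ] K) (x : H) :
    ‖toDefect D x‖ = ‖D x‖ := rfl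

theorem aux_extend {H K L : Type*} [NormedAddCommGroup H] [InnerProductSpace ℂ H]
    [NormedAddCommGroup K] [InnerProductSpace ℂ K]
    [NormedAddCommGroup L] [InnerProductSpace ℂ L] [CompleteSpace L] (D : H →L[ℂ] K)
    (T : H →L[ℂ] L) (M : ℝ) (hM : 0 ≤ M) (h : ∀ x, ‖T x‖ ≤ M * ‖D x‖) :
    ∃ S : ↥(defectSpace D) →L[ℂ] L, ‖S‖ ≤ M ∧ ∀ x, S (toDefect D x) = T x :=
  ⟨LinearMap.extendOfNorm (T : H →ₗ[ℂ] L) (toDefect D : H →ₗ[ℂ] ↥(defectSpace D)),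
    LinearMap.opNorm_extendOfNorm_le (aux_dense D) hM h,
    fun x => LinearMap.extendOfNorm_eq (f := (T : H →ₗ[ℂ] L))
      (e := (toDefect D : H →ₗ[ℂ] ↥(defectSpace D))) (aux_dense D) ⟨M, h⟩ x⟩

theorem aux_sqrt {X Y : Type*} [NormedAddCommGroup X] [InnerProductSpace ℂ X] [CompleteSpace X]
    [NormedAddCommGroup Y] [InnerProductSpace ℂ Y] [CompleteSpace Y]
    (C : X →L[ℂ] Y) (hC : ‖C‖ ≤ 1) :
    ∃ D : X →L[ℂ] X, D.IsPositive ∧ D.comp D = 1 - (adjoint C).comp C := by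
  have h0 : 0 ≤ 1 - (adjoint C).comp C := by
    rw [nonneg_iff_isPositive, isPositive_def']
    constructor
    · refine IsSelfAdjoint.sub (IsSelfAdjoint.one _) ?_
      rw [isSelfAdjoint_iff', adjoint_comp, adjoint_adjoint]
    · intro x
      have : ‖C x‖ ^ 2 ≤ ‖x‖ ^ 2 := by
        have := C.le_of_opNorm_le hC x
        gcongr; simpa using this
      have h1 : (1 : X →L[ℂ] X) x = x := rfl
      simp only [reApplyInnerSelf, sub_apply, h1, comp_apply, inner_sub_left,
        adjoint_inner_left, inner_self_eq_norm_sq_to_K]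
      norm_cast
      linarith
  refine ⟨CFC.sqrt (1 - (adjoint C).comp C), ?_, CFC.sqrt_mul_sqrt_self _ h0⟩
  rw [← nonneg_iff_isPositive]
  exact CFC.sqrt_nonneg _

theorem aux_defect_norm {X Y : Type*} [NormedAddCommGroup X] [InnerProductSpace ℂ X]
    [CompleteSpace X] [NormedAddCommGroup Y] [InnerProductSpace ℂ Y] [CompleteSpace Y]
    (C : X →L[ℂ] Y) (D : X →L[ℂ] X) (hD : D.IsPositive)
    (h : D.comp D = 1 - (adjoint C).comp C) (x : X) : ‖D x‖ ^ 2 + ‖C x‖ ^ 2 = ‖x‖ ^ 2 := by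
  have h1 : inner ℂ (D (D x)) x = inner ℂ (x - adjoint C (C x)) x := by
    have := DFunLike.congr_fun h x
    simp only [comp_apply, sub_apply] at this
    rw [this]
    rfl
  have hs : inner ℂ (D (D x)) x = inner ℂ (D x) (D x) := hD.isSymmetric (D x) x
  rw [hs, inner_sub_left, adjoint_inner_left] at h1
  simp only [inner_self_eq_norm_sq_to_K] at h1
  have h2 : ‖D x‖ ^ 2 = ‖x‖ ^ 2 - ‖C x‖ ^ 2 := by exact_mod_cast h1
  linarith

variable {X Y Z W : Type*} [NormedAddCommGroup X] [InnerProductSpace ℂ X] [CompleteSpace X]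
    [NormedAddCommGroup Y] [InnerProductSpace ℂ Y] [CompleteSpace Y]
    [NormedAddCommGroup Z] [InnerProductSpace ℂ Z] [CompleteSpace Z]
    [NormedAddCommGroup W] [InnerProductSpace ℂ W] [CompleteSpace W]

theorem aux_key (C : X →L[ℂ] Y) (A : Z →L[ℂ] W) (B : X →L[ℂ] W)
    (h : ∀ x z, ‖C x‖ ^ 2 + ‖B x + A z‖ ^ 2 ≤ ‖x‖ ^ 2 + ‖z‖ ^ 2)
    (DC : X →L[ℂ] X) (DA : W →L[ℂ] W)
    (hDC : ∀ x, ‖DC x‖ ^ 2 + ‖C x‖ ^ 2 = ‖x‖ ^ 2)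
    (hDA : ∀ w, ‖DA w‖ ^ 2 + ‖adjoint A w‖ ^ 2 = ‖w‖ ^ 2) (w : W) (x : X) :
    ‖inner ℂ w (B x)‖ ≤ ‖DA w‖ * ‖DC x‖ := by
  set c : ℂ := inner ℂ w (B x) with hc
  set x' : X := (starRingEnd ℂ c) • x with hx'
  set z : Z := ((‖DC x‖ ^ 2 : ℝ) : ℂ) • adjoint A w with hz
  have e1 : inner ℂ w (B x' + A z) =
      ((‖c‖ ^ 2 + ‖DC x‖ ^ 2 * ‖adjoint A w‖ ^ 2 : ℝ) : ℂ) := by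
    rw [inner_add_right, ← adjoint_inner_left A, hx', hz, map_smul, inner_smul_right,
      inner_smul_right, ← hc, inner_self_eq_norm_sq_to_K, Complex.conj_mul']
    push_cast
    rfl
  have e2 : ‖c‖ ^ 2 + ‖DC x‖ ^ 2 * ‖adjoint A w‖ ^ 2 ≤ ‖w‖ * ‖B x' + A z‖ := by
    have := norm_inner_le_norm (𝕜 := ℂ) w (B x' + A z)
    rw [e1, Complex.norm_real, Real.norm_of_nonneg (by positivity)] at this
    exact this
  have e3 : ‖B x' + A z‖ ^ 2 ≤ ‖DC x‖ ^ 2 * (‖c‖ ^ 2 + ‖DC x‖ ^ 2 * ‖adjoint A w‖ ^ 2) := by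
    have h1 := h x' z
    have h2 := hDC x'
    have h3 : ‖DC x'‖ = ‖c‖ * ‖DC x‖ := by
      rw [hx', map_smul, norm_smul, RCLike.norm_conj]
    have h4 : ‖z‖ = ‖DC x‖ ^ 2 * ‖adjoint A w‖ := by
      rw [hz, norm_smul, Complex.norm_real, Real.norm_of_nonneg (by positivity)]
    rw [h3] at h2
    rw [h4] at h1
    nlinarith
  have hw := hDA w
  apply abs_le_of_sq_le_sq' _ (by positivity) |>.2
  set q := ‖c‖ ^ 2 + ‖DC x‖ ^ 2 * ‖adjoint A w‖ ^ 2 with hq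
  have q0 : 0 ≤ q := by positivity
  have e4 : q ^ 2 ≤ ‖w‖ ^ 2 * (‖DC x‖ ^ 2 * q) := by
    calc q ^ 2 ≤ (‖w‖ * ‖B x' + A z‖) ^ 2 := by gcongr
      _ = ‖w‖ ^ 2 * ‖B x' + A z‖ ^ 2 := by ring
      _ ≤ _ := by gcongr
  have e5 : q ≤ ‖w‖ ^ 2 * ‖DC x‖ ^ 2 := by
    rcases q0.eq_or_lt with h0 | h0
    · rw [← h0]; positivity
    · refine le_of_mul_le_mul_right ?_ h0
      nlinarith
  rw [← hw, hq] at e5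
  nlinarith

theorem aux_core (C : X →L[ℂ] Y) (A : Z →L[ℂ] W) (B : X →L[ℂ] W) :
    (∀ x z, ‖C x‖ ^ 2 + ‖B x + A z‖ ^ 2 ≤ ‖x‖ ^ 2 + ‖z‖ ^ 2) ↔
      ‖C‖ ≤ 1 ∧ ‖A‖ ≤ 1 ∧
        ∃ (DC : X →L[ℂ] X) (DsA : W →L[ℂ] W),
          DC.IsPositive ∧ DC.comp DC = 1 - (adjoint C).comp C ∧
          DsA.IsPositive ∧ DsA.comp DsA = 1 - A.comp (adjoint A) ∧
          ∃ γ : ↥(defectSpace DsA) →L[ℂ] ↥(defectSpace DC), ‖γ‖ ≤ 1 ∧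
            adjoint B =
              ((DC.comp ((defectSpace DC).subtypeL)).comp γ).comp (toDefect DsA) := by
  constructor
  · intro h
    have hC : ‖C‖ ≤ 1 := by
      refine C.opNorm_le_bound zero_le_one fun x => ?_
      have := h x 0
      refine abs_le_of_sq_le_sq' ?_ (by positivity) |>.2
      simp only [norm_zero] at this
      nlinarith [sq_nonneg ‖B x + A 0‖]
    have hA : ‖A‖ ≤ 1 := by
      refine A.opNorm_le_bound zero_le_one fun z => ?_
      have := h 0 z
      refine abs_le_of_sq_le_sq' ?_ (by positivity) |>.2
      simpa using this
    obtain ⟨DC, pDC, hDC⟩ := aux_sqrt C hC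
    obtain ⟨DA, pDA, hDA⟩ := aux_sqrt (adjoint A) (by simpa using hA)
    have nC := aux_defect_norm C DC pDC hDC
    have nA := aux_defect_norm (adjoint A) DA pDA hDA
    rw [adjoint_adjoint] at hDA
    refine ⟨hC, hA, DC, DA, pDC, hDC, pDA, hDA, ?_⟩
    have key := aux_key C A B h DC DA nC nA
    have hDA1 : ∀ w, ‖DA w‖ ≤ ‖w‖ := fun w => by
      refine abs_le_of_sq_le_sq' ?_ (by positivity) |>.2
      nlinarith [nA w, sq_nonneg ‖adjoint A w‖]
    obtain ⟨T, -, hT⟩ := aux_extend DC B 1 zero_le_one (fun x => by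
      have h1 := key (B x) x
      rw [inner_self_eq_norm_sq_to_K] at h1
      have h2 : ‖B x‖ ^ 2 ≤ ‖DA (B x)‖ * ‖DC x‖ := by
        refine le_trans (le_of_eq ?_) h1
        simp
      have h3 : ‖B x‖ * ‖B x‖ ≤ ‖B x‖ * ‖DC x‖ := by
        rw [← sq]; exact h2.trans (by gcongr; exact hDA1 _)
      rcases (norm_nonneg (B x)).eq_or_lt with h0 | h0
      · rw [← h0]; positivity
      · rw [one_mul]; exact le_of_mul_le_mul_left h3 h0)
    have : CompleteSpace ↥(defectSpace DC) :=
      (Submodule.isClosed_topologicalClosure _).completeSpace_coe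
    have hTu : ∀ w u, ‖inner ℂ w (T u)‖ ≤ ‖DA w‖ * ‖u‖ := by
      intro w u
      refine (aux_dense DC).induction_on (p := fun u => ‖inner ℂ w (T u)‖ ≤ ‖DA w‖ * ‖u‖) u
        (isClosed_le (by fun_prop) (by fun_prop)) fun x => ?_
      rw [hT]
      exact key w x
    obtain ⟨γ, hγ, hγ'⟩ := aux_extend DA (adjoint T) 1 zero_le_one (fun w => by
      have h1 := hTu w (adjoint T w)
      rw [← adjoint_inner_left, inner_self_eq_norm_sq_to_K] at h1
      have h2 : ‖adjoint T w‖ * ‖adjoint T w‖ ≤ ‖DA w‖ * ‖adjoint T w‖ := by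
        refine le_trans (le_of_eq ?_) h1
        simp [sq]
      rcases (norm_nonneg (adjoint T w)).eq_or_lt with h0 | h0
      · rw [← h0]; positivity
      · rw [one_mul]; exact le_of_mul_le_mul_right h2 h0)
    refine ⟨γ, hγ, ?_⟩
    ext1 w
    refine ext_inner_right ℂ fun x => ?_
    simp only [comp_apply, hγ', adjoint_inner_left]
    have hs : inner ℂ (DC ((defectSpace DC).subtypeL (adjoint T w))) x =
      inner ℂ ((defectSpace DC).subtypeL (adjoint T w)) (DC x) := pDC.isSymmetric _ x
    rw [hs, ← hT, ← adjoint_inner_left]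
    rfl
  · rintro ⟨hC, hA, DC, DA, pDC, hDC, pDA, hDA, γ, hγ, hB⟩ x z
    have nC := aux_defect_norm C DC pDC hDC x
    have nA := aux_defect_norm (adjoint A) DA pDA (by rw [adjoint_adjoint]; exact hDA)
    set w := B x + A z with hw
    have nw := nA w
    have h1 : ‖inner ℂ w (B x)‖ ≤ ‖DA w‖ * ‖DC x‖ := by
      rw [← adjoint_inner_left, hB]
      simp only [comp_apply]
      have hs : inner ℂ (DC ((defectSpace DC).subtypeL (γ (toDefect DA w)))) x =
        inner ℂ ((defectSpace DC).subtypeL (γ (toDefect DA w))) (DC x) := pDC.isSymmetric _ x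
      rw [hs]
      refine (norm_inner_le_norm _ _).trans ?_
      gcongr
      have := γ.le_of_opNorm_le hγ (toDefect DA w)
      rw [one_mul] at this
      exact this
    have h2 : ‖inner ℂ w (A z)‖ ≤ ‖adjoint A w‖ * ‖z‖ := by
      rw [← adjoint_inner_left]
      exact norm_inner_le_norm _ _
    have h3 : ‖w‖ ^ 2 ≤ ‖DA w‖ * ‖DC x‖ + ‖adjoint A w‖ * ‖z‖ := by
      have : ‖inner ℂ w w‖ = ‖w‖ ^ 2 := by
        rw [inner_self_eq_norm_sq_to_K]; simp
      rw [← this]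
      nth_rw 2 [hw]
      rw [inner_add_right]
      exact (norm_add_le _ _).trans (add_le_add h1 h2)
    nlinarith [sq_nonneg (‖DA w‖ - ‖DC x‖), sq_nonneg (‖adjoint A w‖ - ‖z‖)]

end Aux

theorem aux_rowOp {d : ℕ} {H K : Type*} [NormedAddCommGroup H] [InnerProductSpace ℂ H]
    [NormedAddCommGroup K] [InnerProductSpace ℂ K] (A : Fin d → (H →L[ℂ] K)) (x : Hd d H) :
    rowOp A x = ∑ i, A i (x i) := by
  simp [rowOp]

theorem aux_pair_norm {d : ℕ} {H K : Type*} [NormedAddCommGroup H] [InnerProductSpace ℂ H]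
    [NormedAddCommGroup K] [InnerProductSpace ℂ K] (x : Hd d H) (z : Hd d K) :
    ‖pairup x z‖ ^ 2 = ‖x‖ ^ 2 + ‖z‖ ^ 2 := by
  rw [PiLp.norm_sq_eq_of_L2, PiLp.norm_sq_eq_of_L2, PiLp.norm_sq_eq_of_L2,
    ← Finset.sum_add_distrib]
  refine Finset.sum_congr rfl fun i _ => ?_
  rw [WithLp.prod_norm_sq_eq_of_L2]
  rfl

theorem aux_pair_surj {d : ℕ} {H K : Type*} [NormedAddCommGroup H] [InnerProductSpace ℂ H]
    [NormedAddCommGroup K] [InnerProductSpace ℂ K] (e : Hd d (WithLp 2 (H × K))) :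
    ∃ (x : Hd d H) (z : Hd d K), e = pairup x z :=
  ⟨WithLp.toLp 2 fun i => (e i).fst, WithLp.toLp 2 fun i => (e i).snd, rfl⟩

theorem aux_row_block {d : ℕ} {H_C H_A : Type*}
    [NormedAddCommGroup H_C] [InnerProductSpace ℂ H_C]
    [NormedAddCommGroup H_A] [InnerProductSpace ℂ H_A]
    (C : Fin d → (H_C →L[ℂ] H_C)) (A : Fin d → (H_A →L[ℂ] H_A))
    (B : Fin d → (H_C →L[ℂ] H_A)) (x : Hd d H_C) (z : Hd d H_A) :
    ‖rowOp (fun i => block2 (C i) 0 (B i) (A i)) (pairup x z)‖ ^ 2 =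
      ‖rowOp C x‖ ^ 2 + ‖rowOp B x + rowOp A z‖ ^ 2 := by
  have h1 : prodFst (rowOp (fun i => block2 (C i) 0 (B i) (A i)) (pairup x z)) = rowOp C x := by
    simp only [aux_rowOp, map_sum]
    refine Finset.sum_congr rfl fun i _ => ?_
    simp [block2, prodFst, prodSnd, pairup]
  have h2 : prodSnd (rowOp (fun i => block2 (C i) 0 (B i) (A i)) (pairup x z)) =
      rowOp B x + rowOp A z := by
    simp only [aux_rowOp, map_sum, ← Finset.sum_add_distrib]
    refine Finset.sum_congr rfl fun i _ => ?_
    simp [block2, prodFst, prodSnd, pairup]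
  rw [WithLp.prod_norm_sq_eq_of_L2, ← h1, ← h2]
  rfl

open ContinuousLinearMap in
/-- Proposition 3.1 of Dey–Gohm. The block tuple
`E_i = [[C_i, 0], [B_i, A_i]]` is a row contraction iff `C` and `A` are row contractions and
there is a contraction `γ : 𝒟_{*,A} → 𝒟_C` with `𝐁* = D_C ∘ γ ∘ D_{*,A}`. -/
theorem statement4 {d : ℕ} {H_C H_A : Type*}
    [NormedAddCommGroup H_C] [InnerProductSpace ℂ H_C] [CompleteSpace H_C]
    [NormedAddCommGroup H_A] [InnerProductSpace ℂ H_A] [CompleteSpace H_A]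
    (C : Fin d → (H_C →L[ℂ] H_C)) (A : Fin d → (H_A →L[ℂ] H_A))
    (B : Fin d → (H_C →L[ℂ] H_A))
    (E : Fin d → (WithLp 2 (H_C × H_A) →L[ℂ] WithLp 2 (H_C × H_A)))
    (hE : ∀ i, E i = block2 (C i) 0 (B i) (A i)) :
    ‖rowOp E‖ ≤ 1 ↔
      ‖rowOp C‖ ≤ 1 ∧ ‖rowOp A‖ ≤ 1 ∧
        ∃ (DC : Hd d H_C →L[ℂ] Hd d H_C) (DsA : H_A →L[ℂ] H_A),
          DC.IsPositive ∧ DC.comp DC = 1 - (adjoint (rowOp C)).comp (rowOp C) ∧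
          DsA.IsPositive ∧ DsA.comp DsA = 1 - (rowOp A).comp (adjoint (rowOp A)) ∧
          ∃ γ : ↥(defectSpace DsA) →L[ℂ] ↥(defectSpace DC), ‖γ‖ ≤ 1 ∧
            adjoint (rowOp B) =
              ((DC.comp ((defectSpace DC).subtypeL)).comp γ).comp (toDefect DsA) := by
  obtain rfl : E = fun i => block2 (C i) 0 (B i) (A i) := funext hE
  rw [← aux_core (rowOp C) (rowOp A) (rowOp B)]
  constructor
  · intro h x z
    rw [← aux_row_block, ← aux_pair_norm]
    have := ContinuousLinearMap.le_of_opNorm_le _ h (pairup x z)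
    rw [one_mul] at this
    gcongr
  · intro h
    refine ContinuousLinearMap.opNorm_le_bound _ zero_le_one fun e => ?_
    obtain ⟨x, z, rfl⟩ := aux_pair_surj e
    have := h x z
    rw [← aux_row_block, ← aux_pair_norm] at this
    rw [one_mul]
    exact abs_le_of_sq_le_sq' this (norm_nonneg _) |>.2
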